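/- There exists N such that for all n ≥ N, with probability at least 1 − 1/n when y is chosen uniformly at random from the Euclidean unit sphere S_2^{n−1} ⊂ ℝ^n, one has exp( n^{−1/2}·‖y‖_1 − 1 ) < 0.82, where ‖y‖_1 = ∑_{i=1}^n |y_i|. -/

import Mathlib

open MeasureTheory Finset

/-- The normalized surface area (Haar) measure on the Euclidean unit sphere in `ℝⁿ`:
the unique rotation-invariant probability measure on the sphere, obtained by
normalizing the surface measure to have total mass one. -/
noncomputable def sphereHaar (n : ℕ) :
    Measure (Metric.sphere (0 : EuclideanSpace ℝ (Fin n)) 1) :=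
  ((volume : Measure (EuclideanSpace ℝ (Fin n))).toSphere Set.univ)⁻¹ •
    (volume : Measure (EuclideanSpace ℝ (Fin n))).toSphere

theorem aux_prod (n : ℕ) (f : ℝ → ℝ) (hf : Continuous f) (h0 : ∀ x, 0 ≤ f x) (hi : Integrable f) :
    ∫⁻ x : EuclideanSpace ℝ (Fin n), ENNReal.ofReal (∏ i, f (x i)) =
      ENNReal.ofReal ((∫ x, f x) ^ n) := by
  have h := (PiLp.volume_preserving_ofLp (Fin n)).lintegral_comp
    (f := fun x : Fin n → ℝ => ENNReal.ofReal (∏ i, f (x i))) (by fun_prop)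
  rw [show (∫⁻ x : EuclideanSpace ℝ (Fin n), ENNReal.ofReal (∏ i, f (x i))) =
    ∫⁻ x : Fin n → ℝ, ENNReal.ofReal (∏ i, f (x i)) from h]
  rw [← ofReal_integral_eq_lintegral_ofReal]
  · rw [integral_fintype_prod_volume_eq_pow, Fintype.card_fin]
  · exact Integrable.fintype_prod (fun _ => hi)
  · exact Filter.Eventually.of_forall fun x => Finset.prod_nonneg fun i _ => h0 _

theorem aux_polar {E : Type*} [NormedAddCommGroup E] [NormedSpace ℝ E] [MeasurableSpace E]
    [BorelSpace E] [FiniteDimensional ℝ E] [Nontrivial E] (μ : Measure E) [μ.IsAddHaarMeasure]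
    (F : E → ENNReal) (hF : Measurable F) :
    ∫⁻ x, F x ∂μ = ∫⁻ y : Metric.sphere (0 : E) 1, ∫⁻ r : Set.Ioi (0:ℝ), F (r.1 • y.1)
      ∂(Measure.volumeIoiPow (Module.finrank ℝ E - 1)) ∂μ.toSphere := by
  rw [← restrict_compl_singleton (μ := μ) 0,
    ← lintegral_subtype_comap (measurableSet_singleton _).compl]
  rw [restrict_compl_singleton (μ := μ) 0]
  have hm : Measurable fun p : Metric.sphere (0 : E) 1 × Set.Ioi (0:ℝ) => F (p.2.1 • p.1.1) := by
    apply hF.comp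
    fun_prop
  have := μ.measurePreserving_homeomorphUnitSphereProd.lintegral_comp hm
  rw [lintegral_prod _ hm.aemeasurable] at this
  rw [← this]
  refine lintegral_congr fun x => ?_
  congr 1
  simp only [homeomorphUnitSphereProd_apply_snd_coe, homeomorphUnitSphereProd_apply_fst_coe]
  have : ‖x.1‖ ≠ 0 := norm_ne_zero_iff.2 x.2
  rw [smul_smul, mul_inv_cancel₀ this, one_smul]

theorem aux_abs : ∫ x : ℝ, |x| * Real.exp (-(1/2) * x^2) = 2 := by
  have h := integral_comp_abs (f := fun x : ℝ => x * Real.exp (-(1/2) * x^2))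
  simp only [sq_abs] at h
  rw [h]
  have h2 := integral_rpow_mul_exp_neg_mul_rpow (p := 2) (q := 1) (b := 1/2) (by norm_num)
    (by norm_num) (by norm_num)
  simp only [Real.rpow_one, Real.rpow_two] at h2
  rw [h2]
  norm_num [Real.rpow_neg]

theorem aux_int_abs (t : ℝ) (ht : t ≤ 1) :
    Integrable fun x : ℝ => Real.exp (t * |x| - (1/2) * x^2) := by
  refine Integrable.mono' ((integrable_exp_neg_mul_sq (b := 1/4) (by norm_num)).const_mul
    (Real.exp 1)) (by fun_prop) (Filter.Eventually.of_forall fun x => ?_)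
  rw [Real.norm_eq_abs, Real.abs_exp, ← Real.exp_add]
  apply Real.exp_le_exp.2
  nlinarith [sq_nonneg (|x| - 2), sq_abs x, abs_nonneg x]

theorem aux_int_sq : Integrable fun x : ℝ => x^2 * Real.exp (-(1/4) * x^2) := by
  have := integrable_rpow_mul_exp_neg_mul_sq (b := 1/4) (by norm_num) (s := 2) (by norm_num)
  simpa only [Real.rpow_two] using this

theorem aux_M : ∃ K : ℝ, ∀ t : ℝ, 0 ≤ t → t ≤ 1 →
    ∫ x : ℝ, Real.exp (t * |x| - (1/2) * x^2) ≤ √(2 * Real.pi) + 2 * t + K * t^2 := by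
  refine ⟨Real.exp 1 * ∫ x : ℝ, x^2 * Real.exp (-(1/4) * x^2), fun t h0 h1 => ?_⟩
  have i1 := integrable_exp_neg_mul_sq (b := 1/2) (by norm_num)
  have i2 : Integrable fun x : ℝ => |x| * Real.exp (-(1/2) * x^2) := by
    by_contra h
    have := integral_undef h
    rw [aux_abs] at this
    norm_num at this
  have i3 := aux_int_sq
  have i12 : Integrable fun x : ℝ =>
      Real.exp (-(1/2) * x^2) + t * (|x| * Real.exp (-(1/2) * x^2)) := i1.add (i2.const_mul t)
  have e : √(2 * Real.pi) + 2 * t + (Real.exp 1 * ∫ x : ℝ, x^2 * Real.exp (-(1/4) * x^2)) * t^2 =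
     ∫ x : ℝ, ((Real.exp (-(1/2) * x^2) + t * (|x| * Real.exp (-(1/2) * x^2))) +
      (Real.exp 1 * t^2) * (x^2 * Real.exp (-(1/4) * x^2))) := by
    rw [integral_add i12 (i3.const_mul _), integral_add i1 (i2.const_mul t),
      integral_const_mul, integral_const_mul, aux_abs, integral_gaussian]
    rw [show Real.pi / (1/2) = 2 * Real.pi by ring]
    ring
  rw [e]
  refine integral_mono (aux_int_abs t h1)
    (i12.add (i3.const_mul _)) fun x => ?_
  simp only
  set u := t * |x| with hu
  have hu0 : 0 ≤ u := by positivity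
  have k1 : Real.exp u ≤ 1 + u + u^2 * Real.exp u := by
    have a := Real.add_one_le_exp (-u)
    have b : Real.exp u * Real.exp (-u) = 1 := by rw [← Real.exp_add]; simp
    have c : Real.exp u ≤ 1 + u * Real.exp u := by nlinarith [Real.exp_pos u]
    nlinarith
  have k2 : Real.exp u * Real.exp (-(1/2) * x^2) ≤ Real.exp 1 * Real.exp (-(1/4) * x^2) := by
    rw [← Real.exp_add, ← Real.exp_add]
    apply Real.exp_le_exp.2
    nlinarith [sq_nonneg (|x| - 2), sq_abs x, abs_nonneg x]
  have k3 : u^2 = t^2 * x^2 := by rw [hu, mul_pow, sq_abs]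
  rw [sub_eq_add_neg, ← neg_mul, Real.exp_add]
  calc Real.exp u * Real.exp (-(1/2) * x^2)
      ≤ (1 + u + u^2 * Real.exp u) * Real.exp (-(1/2) * x^2) := by gcongr
    _ = (1 + u) * Real.exp (-(1/2) * x^2) + u^2 * (Real.exp u * Real.exp (-(1/2) * x^2)) := by ring
    _ ≤ (1 + u) * Real.exp (-(1/2) * x^2) + u^2 * (Real.exp 1 * Real.exp (-(1/4) * x^2)) := by
        gcongr
    _ = _ := by rw [k3, hu]; ring

/-- first Chernoff factor -/
theorem aux_A : ∃ t : ℝ, 0 < t ∧ t ≤ 1 ∧ ∃ α : ℝ, 0 ≤ α ∧ α < 1 ∧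
    ∫ x : ℝ, Real.exp (t * |x| - (1/2) * x^2 - t * 0.8) = α * √(2 * Real.pi) := by
  obtain ⟨K, hK⟩ := aux_M
  set s := √(2 * Real.pi) with hs
  have hs1 : 2.5 < s := by
    rw [hs]; apply Real.lt_sqrt_of_sq_lt; nlinarith [Real.pi_gt_d2]
  set d := 0.8 * s - 2 with hd
  have hd0 : 0 < d := by rw [hd]; linarith
  have hK' : (0:ℝ) < |K| + 1 := by positivity
  obtain ⟨t, ht0, ht1, ht2⟩ : ∃ t : ℝ, 0 < t ∧ t ≤ 1 ∧ t * (|K| + 1) ≤ d / 2 := by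
    refine ⟨min 1 (d / 2 / (|K| + 1)), by positivity, min_le_left _ _, ?_⟩
    calc _ ≤ d / 2 / (|K| + 1) * (|K| + 1) := by gcongr; exact min_le_right _ _
      _ = d / 2 := by field_simp
  refine ⟨t, ht0, ht1, (∫ x : ℝ, Real.exp (t * |x| - (1/2) * x^2 - t * 0.8)) / s, ?_, ?_, ?_⟩
  · exact div_nonneg (integral_nonneg fun x => (Real.exp_pos _).le) (by positivity)
  · rw [div_lt_one (by linarith)]
    have e : ∫ x : ℝ, Real.exp (t * |x| - (1/2) * x^2 - t * 0.8) =
        (∫ x : ℝ, Real.exp (t * |x| - (1/2) * x^2)) * Real.exp (-(t * 0.8)) := by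
      rw [← integral_mul_const]
      congr 1; ext x; rw [← Real.exp_add]; congr 1
    rw [e]
    have h1 := hK t ht0.le ht1
    have h2 : 1 + t * 0.8 ≤ Real.exp (t * 0.8) := by linarith [Real.add_one_le_exp (t * 0.8)]
    rw [Real.exp_neg, ← div_eq_mul_inv, div_lt_iff₀ (Real.exp_pos _)]
    have h3 : K * t^2 ≤ t * (d / 2) := by
      nlinarith [le_abs_self K, abs_nonneg K]
    have h4 : s * (1 + t * 0.8) ≤ s * Real.exp (t * 0.8) := by gcongr
    nlinarith
  · have : s ≠ 0 := by linarith
    rw [div_mul_cancel₀ _ this]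

/-- second Chernoff factor -/
theorem aux_B : ∃ s : ℝ, 0 < s ∧ ∃ β : ℝ, 0 ≤ β ∧ β < 1 ∧
    ∫ x : ℝ, Real.exp (s * (800/801)^2) * Real.exp (-(1/2 + s) * x^2) = β * √(2 * Real.pi) := by
  refine ⟨1/2000, by norm_num,
    Real.exp ((1/2000) * (800/801)^2) * √(1 / (1 + 1/1000)), by positivity, ?_, ?_⟩
  · have h : (Real.exp ((1/2000) * (800/801)^2) * √(1 / (1 + 1/1000)))^2 < 1 := by
      rw [mul_pow, Real.sq_sqrt (by norm_num), ← Real.exp_nat_mul]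
      have h2 := Real.add_one_le_exp (-((2:ℕ) * ((1/2000) * (800/801)^2 : ℝ)))
      rw [Real.exp_neg] at h2
      set e := Real.exp ((2:ℕ) * ((1/2000) * (800/801)^2 : ℝ))
      have he : 0 < e := Real.exp_pos _
      have h3 : e * e⁻¹ = 1 := mul_inv_cancel₀ he.ne'
      norm_num at h2 ⊢
      nlinarith
    nlinarith [h, sq_nonneg (Real.exp ((1/2000) * (800/801)^2) * √(1 / (1 + 1/1000)) - 1)]
  · rw [integral_const_mul, integral_gaussian, mul_assoc, ← Real.sqrt_mul (by norm_num)]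
    congr 2
    norm_num
    ring

theorem aux_pt (n : ℕ) (y : EuclideanSpace ℝ (Fin n)) (hn : 0 < n)
    (hy : ¬ Real.exp ((n : ℝ) ^ (-(1 : ℝ)/2) * ∑ i, |y i| - 1) < 0.82) :
    0.801 * √n ≤ ∑ i, |y i| := by
  have hn' : (0:ℝ) < n := by exact_mod_cast hn
  have h1 : Real.exp (-0.199) < 0.82 := by
    have h := Real.quadratic_le_exp_of_nonneg (x := 0.199) (by norm_num)
    rw [Real.exp_neg, inv_lt_comm₀ (Real.exp_pos _) (by norm_num)]
    have h3 := Real.sum_le_exp_of_nonneg (x := 0.199) (by norm_num) 5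
    norm_num [Finset.sum_range_succ, Nat.factorial] at h3 ⊢
    linarith
  have h2 := h1.trans_le (not_lt.1 hy)
  rw [Real.exp_lt_exp] at h2
  have h3 : (n:ℝ) ^ (-(1:ℝ)/2) = (√n)⁻¹ := by
    rw [neg_div, Real.rpow_neg hn'.le, Real.sqrt_eq_rpow]
  rw [h3] at h2
  have h4 : 0.801 < (√n)⁻¹ * ∑ i, |y i| := by linarith
  have h5 : 0 < √(n:ℝ) := Real.sqrt_pos.2 hn'
  rw [inv_mul_eq_div, lt_div_iff₀ h5] at h4
  exact h4.le

theorem aux_bad (n : ℕ) (hn : 0 < n) (t s α β : ℝ) (ht : 0 < t) (ht1 : t ≤ 1) (hs : 0 < s)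
    (hα : 0 ≤ α) (hβ : 0 ≤ β)
    (hA : ∫ x : ℝ, Real.exp (t * |x| - (1/2) * x^2 - t * 0.8) = α * √(2 * Real.pi))
    (hB : ∫ x : ℝ, Real.exp (s * (800/801)^2) * Real.exp (-(1/2 + s) * x^2) = β * √(2 * Real.pi))
    (S : Set (Metric.sphere (0 : EuclideanSpace ℝ (Fin n)) 1)) (hS : MeasurableSet S)
    (hSb : ∀ y ∈ S, 0.801 * √n ≤ ∑ i, |(y : EuclideanSpace ℝ (Fin n)) i|) :
    (volume : Measure (EuclideanSpace ℝ (Fin n))).toSphere S ≤ ENNReal.ofReal (α^n + β^n) *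
      (volume : Measure (EuclideanSpace ℝ (Fin n))).toSphere Set.univ := by
  have : NeZero n := ⟨hn.ne'⟩
  set E := EuclideanSpace ℝ (Fin n) with hE
  set σ := (volume : Measure E).toSphere with hσ
  set ν := Measure.volumeIoiPow (Module.finrank ℝ E - 1)
  set c := √(2 * Real.pi) with hc
  have hc0 : 0 < c := Real.sqrt_pos.2 (by positivity)
  set fA : ℝ → ℝ := fun x => Real.exp (t * |x| - (1/2) * x^2 - t * 0.8) with hfA
  set fB : ℝ → ℝ := fun x => Real.exp (s * (800/801)^2) * Real.exp (-(1/2 + s) * x^2) with hfB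
  set fG : ℝ → ℝ := fun x => Real.exp (-(1/2) * x^2) with hfG
  have iA := aux_prod n fA (by fun_prop) (fun x => (Real.exp_pos _).le) (by
    by_contra h
    have h2 := (aux_int_abs t ht1).mul_const (Real.exp (-(t*0.8)))
    apply h
    refine h2.congr (Filter.Eventually.of_forall fun x => ?_)
    simp only [hfA]
    rw [← Real.exp_add]; congr 1)
  have iB := aux_prod n fB (by fun_prop) (fun x => by positivity)
    ((integrable_exp_neg_mul_sq (by positivity)).const_mul _)
  have iG := aux_prod n fG (by fun_prop) (fun x => (Real.exp_pos _).le)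
    (integrable_exp_neg_mul_sq (by norm_num))
  rw [hA] at iA
  rw [hB] at iB
  have hG : ∫ x, fG x = c := by
    rw [hfG, integral_gaussian, show Real.pi / (1/2) = 2 * Real.pi by ring]
  rw [hG] at iG
  have hnorm : ∀ x : E, ∑ i, (x i)^2 = ‖x‖^2 := fun x => by
    rw [EuclideanSpace.norm_sq_eq]; simp
  -- products as exponentials
  have pG : ∀ x : E, ∏ i, fG (x i) = Real.exp (-(1/2) * ‖x‖^2) := fun x => by
    rw [← Real.exp_sum, ← hnorm, Finset.mul_sum]
  have pA : ∀ x : E, ∏ i, fA (x i) =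
      Real.exp (t * (∑ i, |x i| - 0.8 * n)) * Real.exp (-(1/2) * ‖x‖^2) := fun x => by
    rw [← Real.exp_sum, ← Real.exp_add, ← hnorm]
    congr 1
    rw [Finset.sum_sub_distrib, Finset.sum_sub_distrib, ← Finset.mul_sum, ← Finset.mul_sum]
    simp
    ring
  have pB : ∀ x : E, ∏ i, fB (x i) =
      Real.exp (s * ((800/801)^2 * n - ‖x‖^2)) * Real.exp (-(1/2) * ‖x‖^2) := fun x => by
    simp only [hfB, ← Real.exp_add]
    rw [← Real.exp_sum, ← hnorm]
    congr 1
    rw [Finset.sum_add_distrib, Finset.sum_const, Finset.card_fin, nsmul_eq_mul, ← Finset.mul_sum]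
    ring
  set G := ∫⁻ r : Set.Ioi (0:ℝ), ENNReal.ofReal (Real.exp (-(1/2) * r.1^2)) ∂ν with hGdef
  have hUG : σ Set.univ * G = ENNReal.ofReal (c^n) := by
    rw [← iG, aux_polar volume _ (by fun_prop)]
    simp only [pG]
    rw [mul_comm, ← lintegral_const]
    refine lintegral_congr fun y => lintegral_congr fun r => ?_
    have : ‖(y : E)‖ = 1 := by simpa using y.2
    rw [norm_smul, this, mul_one, Real.norm_eq_abs, sq_abs]
  have hTG : σ S * G ≤ ENNReal.ofReal ((α * c)^n) + ENNReal.ofReal ((β * c)^n) := by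
    rw [← iA, ← iB, ← lintegral_add_left (by fun_prop), aux_polar volume _ (by fun_prop)]
    rw [mul_comm, ← setLIntegral_const]
    refine le_trans ?_ (setLIntegral_le_lintegral S _)
    refine setLIntegral_mono' hS fun y hy => lintegral_mono fun r => ?_
    have hy1 : ‖(y : E)‖ = 1 := by simpa using y.2
    have hr : 0 < r.1 := r.2
    rw [pA, pB, ← ENNReal.ofReal_add (by positivity) (by positivity)]
    apply ENNReal.ofReal_le_ofReal
    rw [norm_smul, hy1, mul_one, Real.norm_eq_abs, sq_abs, ← add_mul]
    have key : 1 ≤ Real.exp (t * (∑ i, |(r.1 • (y:E)) i| - 0.8 * n)) +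
        Real.exp (s * ((800/801)^2 * n - r.1^2)) := by
      have e1 : ∑ i, |(r.1 • (y:E)) i| = r.1 * ∑ i, |(y:E) i| := by
        rw [Finset.mul_sum]
        refine Finset.sum_congr rfl fun i _ => ?_
        rw [show (r.1 • (y:E)) i = r.1 * (y:E) i from rfl, abs_mul, abs_of_pos hr]
      rw [e1]
      have hb := hSb y hy
      have hsq : √(n:ℝ) * √n = n := Real.mul_self_sqrt (by positivity)
      have hsp : 0 ≤ √(n:ℝ) := Real.sqrt_nonneg _
      rcases le_total r.1 (800/801 * √n) with h | h
      · have : r.1^2 ≤ (800/801)^2 * n := by nlinarith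
        have := Real.one_le_exp (x := s * ((800/801)^2 * n - r.1^2))
          (mul_nonneg hs.le (by linarith))
        linarith [Real.exp_pos (t * (r.1 * ∑ i, |(y:E) i| - 0.8 * n))]
      · have : 0.8 * n ≤ r.1 * ∑ i, |(y:E) i| := by
          calc (0.8:ℝ) * n = (800/801 * √n) * (0.801 * √n) := by
                linear_combination (-0.8) * hsq
            _ ≤ _ := by gcongr
        have := Real.one_le_exp (x := t * (r.1 * ∑ i, |(y:E) i| - 0.8 * n))
          (mul_nonneg ht.le (by linarith))
        linarith [Real.exp_pos (s * ((800/801)^2 * n - r.1^2))]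
    calc Real.exp (-(1/2) * r.1^2) = 1 * Real.exp (-(1/2) * r.1^2) := (one_mul _).symm
      _ ≤ _ := by gcongr
  have hU0 : σ Set.univ * G ≠ 0 := by
    rw [hUG]; simp; positivity
  have hG0 : G ≠ 0 := right_ne_zero_of_mul hU0
  have hGt : G ≠ ⊤ := by
    intro h
    rw [h, ENNReal.mul_top (left_ne_zero_of_mul hU0)] at hUG
    exact ENNReal.ofReal_ne_top hUG.symm
  rw [← ENNReal.mul_le_mul_iff_left hG0 hGt, mul_assoc, hUG, ← ENNReal.ofReal_mul (by positivity)]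
  refine hTG.trans_eq ?_
  rw [← ENNReal.ofReal_add (by positivity) (by positivity)]
  congr 1
  ring

theorem aux_lim (α β : ℝ) (hα : 0 ≤ α) (hα1 : α < 1) (hβ : 0 ≤ β) (hβ1 : β < 1) :
    ∃ N : ℕ, ∀ n : ℕ, N ≤ n → n * (α^n + β^n) ≤ 1 := by
  have h1 := tendsto_self_mul_const_pow_of_lt_one hα hα1
  have h2 := tendsto_self_mul_const_pow_of_lt_one hβ hβ1
  have h3 := h1.add h2
  have h4 := h3.eventually (eventually_le_nhds (b := 1) (by norm_num))
  obtain ⟨N, hN⟩ := Filter.eventually_atTop.1 h4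
  exact ⟨N, fun n hn => by rw [mul_add]; exact hN n hn⟩

theorem typical_bound : ∃ N : ℕ, ∀ n : ℕ, N ≤ n →
    1 - 1 / (n : ENNReal)
      ≤ sphereHaar n
          {y : Metric.sphere (0 : EuclideanSpace ℝ (Fin n)) 1 |
            Real.exp ((n : ℝ) ^ (-(1 : ℝ)/2) * ∑ i, |(y : EuclideanSpace ℝ (Fin n)) i| - 1)
              < 0.82} := by
  obtain ⟨t, ht, ht1, α, hα, hα1, hA⟩ := aux_A
  obtain ⟨s, hs, β, hβ, hβ1, hB⟩ := aux_B
  obtain ⟨N, hN⟩ := aux_lim α β hα hα1 hβ hβ1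
  refine ⟨max N 1, fun n hn => ?_⟩
  have hn0 : 0 < n := lt_of_lt_of_le one_pos ((le_max_right _ _).trans hn)
  have hnN := hN n ((le_max_left _ _).trans hn)
  have hn' : (0:ℝ) < n := by exact_mod_cast hn0
  have : NeZero n := ⟨hn0.ne'⟩
  set Gd := {y : Metric.sphere (0 : EuclideanSpace ℝ (Fin n)) 1 |
            Real.exp ((n : ℝ) ^ (-(1 : ℝ)/2) * ∑ i, |(y : EuclideanSpace ℝ (Fin n)) i| - 1)
              < 0.82} with hGd
  have hm : MeasurableSet Gd := measurableSet_lt (by fun_prop) measurable_const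
  have hbad := aux_bad n hn0 t s α β ht ht1 hs hα hβ hA hB Gdᶜ hm.compl
    (fun y hy => aux_pt n y hn0 hy)
  set σ := (volume : Measure (EuclideanSpace ℝ (Fin n))).toSphere with hσ
  have hU0 : σ Set.univ ≠ 0 := by
    rw [Ne, Measure.measure_univ_eq_zero]
    exact Measure.toSphere_ne_zero _
  have hUt : σ Set.univ ≠ ⊤ := measure_ne_top _ _
  have e1 : sphereHaar n Gd + sphereHaar n Gdᶜ = 1 := by
    rw [measure_add_measure_compl hm]
    simp only [sphereHaar, Measure.smul_apply, smul_eq_mul]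
    exact ENNReal.inv_mul_cancel hU0 hUt
  have e2 : sphereHaar n Gdᶜ ≤ 1 / n := by
    simp only [sphereHaar, Measure.smul_apply, smul_eq_mul]
    calc (σ Set.univ)⁻¹ * σ Gdᶜ
        ≤ (σ Set.univ)⁻¹ * (ENNReal.ofReal (α^n + β^n) * σ Set.univ) := by gcongr
      _ = ENNReal.ofReal (α^n + β^n) := by
          rw [mul_left_comm, ENNReal.inv_mul_cancel hU0 hUt, mul_one]
      _ ≤ ENNReal.ofReal (1 / n) := by
          apply ENNReal.ofReal_le_ofReal
          rw [le_div_iff₀ hn']; linarith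
      _ = 1 / n := by
          rw [ENNReal.ofReal_div_of_pos hn']; simp
  rw [tsub_le_iff_right]
  exact e1.symm.le.trans (add_le_add le_rfl e2)
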